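/- Let k and ℓ be integers with k ≥ 1 and 0 ≤ ℓ ≤ k, and let G=(V,E) be a (k,ℓ)-sparse multigraph. If X and Y are (k,ℓ)-blocks of G with X ∩ Y ≠ ∅, then X ∪ Y is a (k,ℓ)-block of G. Consequently, any two distinct (k,ℓ)-components of G are node-disjoint. -/

import Mathlib

/-- A multigraph on node set `V` is given by an edge index type `E` together
with an endpoint map `ends : E → Sym2 V`.  `mIndCount ends X` is the number
of edges with both endpoints in `X`. -/
noncomputable def mIndCount {V E : Type*} (ends : E → Sym2 V) (X : Set V) : ℕ :=
  Nat.card {e : E // ∀ x ∈ ends e, x ∈ X}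

/-- The multigraph is `(k, ℓ)`-sparse: every `X ⊆ V` induces at most
`max {k|X| - ℓ, 0}` edges. -/
def IsKLSparse {V E : Type*} (k ℓ : ℕ) (ends : E → Sym2 V) : Prop :=
  ∀ X : Set V, (mIndCount ends X : ℤ) ≤ max ((k : ℤ) * Nat.card X - ℓ) 0

/-- A `(k, ℓ)`-block: a nonempty node set inducing a `(k, ℓ)`-tight subgraph. -/
def IsKLBlock {V E : Type*} (k ℓ : ℕ) (ends : E → Sym2 V) (X : Set V) : Prop :=
  X.Nonempty ∧ (mIndCount ends X : ℤ) = max ((k : ℤ) * Nat.card X - ℓ) 0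

/-- A `(k, ℓ)`-component: an inclusion-wise maximal `(k, ℓ)`-block. -/
def IsKLComponent {V E : Type*} (k ℓ : ℕ) (ends : E → Sym2 V) (X : Set V) : Prop :=
  IsKLBlock k ℓ ends X ∧ ∀ Y : Set V, IsKLBlock k ℓ ends Y → X ⊆ Y → X = Y

/-- The induced edge count is supermodular. -/
theorem mIndCount_add_le {V E : Type*} [Finite E] (ends : E → Sym2 V) (X Y : Set V) :
    mIndCount ends X + mIndCount ends Y ≤ mIndCount ends (X ∪ Y) + mIndCount ends (X ∩ Y) := by
  have hcount (Z : Set V) : mIndCount ends Z = {e : E | ∀ x ∈ ends e, x ∈ Z}.ncard := rfl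
  have hinter : {e : E | ∀ x ∈ ends e, x ∈ X} ∩ {e : E | ∀ x ∈ ends e, x ∈ Y} =
      {e : E | ∀ x ∈ ends e, x ∈ X ∩ Y} := by
    ext e
    exact ⟨fun h x hx => ⟨h.1 x hx, h.2 x hx⟩,
      fun h => ⟨fun x hx => (h x hx).1, fun x hx => (h x hx).2⟩⟩
  have hunion : {e : E | ∀ x ∈ ends e, x ∈ X} ∪ {e : E | ∀ x ∈ ends e, x ∈ Y} ⊆
      {e : E | ∀ x ∈ ends e, x ∈ X ∪ Y} := by
    rintro e (h | h) x hx
    · exact Or.inl (h x hx)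
    · exact Or.inr (h x hx)
  rw [hcount, hcount, hcount, hcount, ← Set.ncard_union_add_ncard_inter, hinter]
  exact Nat.add_le_add_right (Set.ncard_le_ncard hunion) _

/-- For `ℓ ≤ k` the truncation at zero is inactive on nonempty node sets. -/
theorem max_klBound_eq_of_nonempty {V : Type*} [Finite V] {k ℓ : ℕ} (hℓ : ℓ ≤ k) {X : Set V}
    (hX : X.Nonempty) :
    max ((k : ℤ) * Nat.card X - ℓ) 0 = (k : ℤ) * Nat.card X - ℓ := by
  have hcard : 0 < Nat.card X := (Set.ncard_pos X.toFinite).mpr hX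
  have hle : ℓ ≤ k * Nat.card X := hℓ.trans (Nat.le_mul_of_pos_right k hcard)
  exact max_eq_left (sub_nonneg.mpr (by exact_mod_cast hle))

/-- In a `(k, ℓ)`-sparse multigraph with `ℓ ≤ k`, the union of two intersecting blocks is a
block. -/
theorem IsKLBlock.union {V E : Type*} [Finite V] [Finite E] {k ℓ : ℕ} (hℓ : ℓ ≤ k)
    {ends : E → Sym2 V} (hsparse : IsKLSparse k ℓ ends) {X Y : Set V}
    (hX : IsKLBlock k ℓ ends X) (hY : IsKLBlock k ℓ ends Y) (hXY : (X ∩ Y).Nonempty) :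
    IsKLBlock k ℓ ends (X ∪ Y) := by
  have hne : (X ∪ Y).Nonempty := hX.1.inl
  refine ⟨hne, le_antisymm (hsparse _) ?_⟩
  have hcountX := hX.2
  have hcountY := hY.2
  have hinter := hsparse (X ∩ Y)
  rw [max_klBound_eq_of_nonempty hℓ hX.1] at hcountX
  rw [max_klBound_eq_of_nonempty hℓ hY.1] at hcountY
  rw [max_klBound_eq_of_nonempty hℓ hXY] at hinter
  rw [max_klBound_eq_of_nonempty hℓ hne]
  have hsuper : (mIndCount ends X : ℤ) + mIndCount ends Y ≤
      mIndCount ends (X ∪ Y) + mIndCount ends (X ∩ Y) := by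
    exact_mod_cast mIndCount_add_le ends X Y
  have hcard : (Nat.card ↥(X ∪ Y) : ℤ) + Nat.card ↥(X ∩ Y) = Nat.card X + Nat.card Y := by
    exact_mod_cast Set.ncard_union_add_ncard_inter X Y
  linear_combination hsuper + hinter - hcountX - hcountY + (k : ℤ) * hcard

theorem stmt7 {V E : Type*} [Fintype V] [Fintype E]
    (k ℓ : ℕ) (hk : 1 ≤ k) (hℓ : ℓ ≤ k)
    (ends : E → Sym2 V) (hsparse : IsKLSparse k ℓ ends) :
    (∀ X Y : Set V, IsKLBlock k ℓ ends X → IsKLBlock k ℓ ends Y →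
        (X ∩ Y).Nonempty → IsKLBlock k ℓ ends (X ∪ Y)) ∧
      ∀ X Y : Set V, IsKLComponent k ℓ ends X → IsKLComponent k ℓ ends Y →
        X ≠ Y → X ∩ Y = ∅ := by
  refine ⟨fun X Y hX hY hXY => hX.union hℓ hsparse hY hXY, fun X Y hX hY hne => ?_⟩
  by_contra h
  have hU := hX.1.union hℓ hsparse hY.1 (Set.nonempty_iff_ne_empty.mpr h)
  exact hne ((hX.2 _ hU Set.subset_union_left).trans (hY.2 _ hU Set.subset_union_right).symm)
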